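/- arXiv:1002.1631 — 3 statements merged into one kernel-verified Lean document; each statement's English description precedes it below -/
import Mathlib

section
/- Let σ be a p-simplex with barycentric coordinates λ_0,…,λ_p, let γ be the face spanned by λ_0,…,λ_ℓ and for h = ℓ+1,…,p let φ_h be the face spanned by λ_0,…,λ_ℓ,λ_h. Let E be a smooth function on σ. Then d(E · ω(γ;σ)) = (-1)^{ℓ+1} Σ_{h=ℓ+1}^p ( E + (1/(ℓ+1)) ( Σ_{i=0}^p λ_i ∂E/∂λ_i − ∂E/∂λ_h ) ) ω(φ_h;σ). -/
open scoped BigOperators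

variable {E : Type*} [NormedAddCommGroup E] [NormedSpace ℝ E]

/-- The Whitney form of the ordered tuple of barycentric coordinate functions
`lam 0, …, lam p` : the `p`-form
`ω = p! Σ_i (-1)^i λ_i dλ_0 ∧ ⋯ ∧ \widehat{dλ_i} ∧ ⋯ ∧ dλ_p`,
evaluated at a point `x` on the tuple of vectors `v`. -/
noncomputable def whitneyForm {p : ℕ} (lam : Fin (p + 1) → E → ℝ) (x : E)
    (v : Fin p → E) : ℝ :=
  (Nat.factorial p : ℝ) *
    ∑ i : Fin (p + 1), (-1 : ℝ) ^ (i : ℕ) * lam i x *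
      Matrix.det (Matrix.of fun r c : Fin p => fderiv ℝ (lam (i.succAbove r)) x (v c))

/-- Exterior derivative of a concrete `k`-form (a function of a point and of `k` vectors),
evaluated on constant vector fields:
`(dω)(v_0,…,v_k) = Σ_i (-1)^i ∂_{v_i} (y ↦ ω(y)(v_0,…,\widehat{v_i},…,v_k))`. -/
noncomputable def extDerivAt {k : ℕ} (ω : E → (Fin k → E) → ℝ) (x : E)
    (v : Fin (k + 1) → E) : ℝ :=
  ∑ i : Fin (k + 1), (-1 : ℝ) ^ (i : ℕ) *
    fderiv ℝ (fun y => ω y fun j => v (i.succAbove j)) x (v i)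

/-- The determinant as a continuous alternating map. -/
noncomputable def detCAM (k : ℕ) : (Fin k → ℝ) [⋀^Fin k]→L[ℝ] ℝ :=
  { (Matrix.detRowAlternating : (Fin k → ℝ) [⋀^Fin k]→ₗ[ℝ] ℝ) with
    cont := by
      change Continuous fun M : Matrix (Fin k) (Fin k) ℝ => M.det
      exact continuous_id.matrix_det }

lemma detCAM_apply {k : ℕ} (M : Fin k → Fin k → ℝ) : detCAM k M = Matrix.det (Matrix.of M) := rfl

lemma differentiableAt_detd {k : ℕ} (μ : Fin k → E → ℝ) (x : E)
    (hμ : ∀ r, ContDiffAt ℝ 2 (μ r) x) (w : Fin k → E) :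
    DifferentiableAt ℝ (fun y => Matrix.det
      (Matrix.of fun r c : Fin k => fderiv ℝ (μ r) y (w c))) x := by
  have h : ∀ r c, DifferentiableAt ℝ (fun y => fderiv ℝ (μ r) y (w c)) x := by
    intro r c
    have := ((hμ r).fderiv_right (m := 1) (by norm_num)).differentiableAt (by norm_num)
    exact this.clm_apply (differentiableAt_const _)
  simp only [Matrix.det_apply, Matrix.of_apply]
  fun_prop

lemma sum_fderiv_det_eq_zero {k : ℕ} (μ : Fin k → E → ℝ) (x : E)
    (hμ : ∀ r, ContDiffAt ℝ 2 (μ r) x) (v : Fin (k + 1) → E) :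
    ∑ i : Fin (k + 1), (-1 : ℝ) ^ (i : ℕ) *
      fderiv ℝ (fun y => Matrix.det
        (Matrix.of fun r c : Fin k => fderiv ℝ (μ r) y (v (i.succAbove c)))) x (v i) = 0 := by
  have hf : ContDiffAt ℝ 2 (fun y r => μ r y) x := contDiffAt_pi.2 hμ
  have hp := extDeriv_pullback (ω := fun _ : Fin k → ℝ => detCAM k) (f := fun y r => μ r y)
    (x := x) (differentiableAt_const _) hf (by simp)
  have h0 : extDeriv (fun _ : Fin k → ℝ => detCAM k) (fun r => μ r x) = 0 := by
    ext w
    simp [extDeriv, ContinuousAlternatingMap.alternatizeUncurryFin_apply]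
  rw [h0] at hp
  have hdiff : DifferentiableAt ℝ
      (fun y => (detCAM k).compContinuousLinearMap (fderiv ℝ (fun y r => μ r y) y)) x := by
    have h1 : DifferentiableAt ℝ (fderiv ℝ (fun y r => μ r y)) x :=
      (hf.fderiv_right (m := 1) (by norm_num)).differentiableAt (by norm_num)
    exact (differentiableAt_const (detCAM k)).continuousAlternatingMapCompContinuousLinearMap h1
  have := congrArg (fun f => f v) hp
  simp only [extDeriv_apply hdiff] at this
  simp only [ContinuousAlternatingMap.compContinuousLinearMap_apply] at this
  rw [show (0 : ℝ) = _ from this.symm]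
  refine Finset.sum_congr rfl fun i _ => ?_
  rw [zsmul_eq_mul]
  push_cast
  congr 2
  apply Filter.EventuallyEq.fderiv_eq
  have hev : ∀ᶠ y in nhds x, ∀ r, DifferentiableAt ℝ (μ r) y := by
    rw [Filter.eventually_all]
    intro r
    filter_upwards [(hμ r).eventually (by norm_num)] with y hy
    exact hy.differentiableAt (by norm_num)
  filter_upwards [hev] with y hy
  rw [← Matrix.det_transpose]
  rw [detCAM_apply]
  congr 1
  ext c r
  have : HasFDerivAt (fun y r => μ r y) (ContinuousLinearMap.pi fun r => fderiv ℝ (μ r) y) y :=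
    hasFDerivAt_pi.2 fun r => (hy r).hasFDerivAt
  simp [this.fderiv, Fin.removeNth]

lemma laplace {k : ℕ} (α : Fin (k + 1) → ℝ) (β : Fin k → Fin (k + 1) → ℝ) :
    ∑ i : Fin (k + 1), (-1 : ℝ) ^ (i : ℕ) * (α i *
      Matrix.det (Matrix.of fun r c : Fin k => β r (i.succAbove c))) =
    Matrix.det (Matrix.of (Fin.cons α β : Fin (k + 1) → Fin (k + 1) → ℝ)) := by
  rw [Matrix.det_succ_row_zero]
  refine Finset.sum_congr rfl fun i _ => ?_
  rw [← mul_assoc]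
  congr 1

/-- Move row `j` to the top. -/
lemma det_cons_row {k : ℕ} (B : Fin (k + 1) → Fin (k + 1) → ℝ) (j : Fin (k + 1)) :
    Matrix.det (Matrix.of (Fin.cons (B j) (fun r => B (j.succAbove r)) :
      Fin (k + 1) → Fin (k + 1) → ℝ)) = (-1) ^ (j : ℕ) * Matrix.det (Matrix.of B) := by
  rw [Matrix.det_succ_row_zero, Matrix.det_succ_row (Matrix.of B) j, Finset.mul_sum]
  refine Finset.sum_congr rfl fun i _ => ?_
  have : ((-1 : ℝ) ^ (j : ℕ)) * (-1) ^ (j : ℕ) = 1 := by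
    rw [← mul_pow]; simp
  rw [pow_add, ← mul_assoc, ← mul_assoc, ← mul_assoc, this, one_mul]
  congr 1

lemma det_snoc_row {k : ℕ} (w : Fin (k + 1) → ℝ) (β : Fin k → Fin (k + 1) → ℝ) :
    Matrix.det (Matrix.of (Fin.snoc (α := fun _ => Fin (k + 1) → ℝ) β w)) = (-1) ^ k *
      Matrix.det (Matrix.of (Fin.cons w β : Fin (k + 1) → Fin (k + 1) → ℝ)) := by
  have h := det_cons_row (Fin.snoc (α := fun _ => Fin (k + 1) → ℝ) β w) (Fin.last k)
  simp only [Fin.snoc_last, Fin.succAbove_last, Fin.snoc_castSucc, Fin.val_last] at h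
  rw [h, ← mul_assoc, ← mul_pow]; simp

/-- The determinant with a variable first row, as a linear map. -/
noncomputable def topRow {k : ℕ} (β : Fin k → Fin (k + 1) → ℝ) : (Fin (k + 1) → ℝ) →ₗ[ℝ] ℝ where
  toFun w := Matrix.det (Matrix.of (Fin.cons w β : Fin (k + 1) → Fin (k + 1) → ℝ))
  map_add' a b := by
    simp only [← laplace, ← Finset.sum_add_distrib, Pi.add_apply]
    exact Finset.sum_congr rfl fun i _ => by ring
  map_smul' c a := by
    simp only [← laplace, Pi.smul_apply, smul_eq_mul, Finset.mul_sum, RingHom.id_apply]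
    exact Finset.sum_congr rfl fun i _ => by ring

lemma topRow_row {k : ℕ} (β : Fin k → Fin (k + 1) → ℝ) (j : Fin k) : topRow β (β j) = 0 := by
  apply Matrix.det_zero_of_row_eq (i := 0) (j := j.succ) (Fin.succ_ne_zero j).symm
  rfl

lemma topRow_cons {k : ℕ} (μ : Fin (k + 1) → ℝ) (β : Fin (k + 1) → Fin (k + 1) → ℝ)
    (c : ℝ) (α : Fin (k + 1) → ℝ) :
    topRow (fun j => (Fin.cons (μ j) (β j) : Fin (k + 2) → ℝ)) (Fin.cons c α) =
      c * Matrix.det (Matrix.of β) - ∑ j : Fin (k + 1), (-1 : ℝ) ^ (j : ℕ) * (μ j *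
        Matrix.det (Matrix.of (Fin.cons α (fun r => β (j.succAbove r)) :
          Fin (k + 1) → Fin (k + 1) → ℝ))) := by
  change Matrix.det _ = _
  rw [Matrix.det_succ_column_zero, Fin.sum_univ_succ, sub_eq_add_neg, ← Finset.sum_neg_distrib]
  congr 1
  · simp only [Matrix.of_apply, Fin.val_zero, pow_zero, one_mul, Fin.cons_zero]
    congr 1
  · refine Finset.sum_congr rfl fun j _ => ?_
    simp only [Matrix.of_apply, Fin.cons_succ, Fin.cons_zero, Fin.val_succ, pow_succ]
    have : ((Matrix.of (Fin.cons (Fin.cons c α)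
        (fun j => (Fin.cons (μ j) (β j) : Fin (k + 2) → ℝ)) : Fin (k + 2) → Fin (k + 2) → ℝ)).submatrix
        j.succ.succAbove Fin.succ) = Matrix.of (Fin.cons α (fun r => β (j.succAbove r)) :
          Fin (k + 1) → Fin (k + 1) → ℝ) := by
      ext r c
      refine Fin.cases ?_ (fun r => ?_) r
      · simp
      · simp
    rw [this]; ring

lemma whitney_eq_det {p : ℕ} (lam : Fin (p + 1) → E → ℝ) (x : E) (v : Fin p → E) :
    whitneyForm lam x v = (p.factorial : ℝ) * Matrix.det (Matrix.of fun j =>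
      (Fin.cons (lam j x) (fun c => fderiv ℝ (lam j) x (v c)) : Fin (p + 1) → ℝ)) := by
  rw [whitneyForm, Matrix.det_succ_column_zero]
  congr 1

lemma whitney_snoc {p : ℕ} (μ : Fin (p + 1) → E → ℝ) (g : E → ℝ) (x : E) (v : Fin (p + 1) → E) :
    whitneyForm (Fin.snoc (α := fun _ => E → ℝ) μ g) x v =
      ((p + 1).factorial : ℝ) * ((-1) ^ (p + 1) * topRow (fun j => (Fin.cons (μ j x)
        (fun c => fderiv ℝ (μ j) x (v c)) : Fin (p + 2) → ℝ))
        (Fin.cons (g x) (fun c => fderiv ℝ g x (v c)))) := by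
  rw [whitney_eq_det]
  congr 1
  refine Eq.trans ?_ (det_snoc_row _ _)
  congr 2
  funext j
  refine Fin.lastCases ?_ (fun j => ?_) j <;> simp

lemma extDerivAt_smul_whitney {ℓ : ℕ} (μ : Fin (ℓ + 1) → E → ℝ) (f : E → ℝ) (x : E)
    (hμ : ∀ r, ContDiffAt ℝ 2 (μ r) x) (hf : DifferentiableAt ℝ f x) (v : Fin (ℓ + 1) → E) :
    extDerivAt (fun y w => f y * whitneyForm μ y w) x v =
      (ℓ.factorial : ℝ) * (∑ j : Fin (ℓ + 1), (-1 : ℝ) ^ (j : ℕ) * (μ j x *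
        Matrix.det (Matrix.of (Fin.cons (fun c => fderiv ℝ f x (v c))
          (fun r c => fderiv ℝ (μ (j.succAbove r)) x (v c)) : Fin (ℓ + 1) → Fin (ℓ + 1) → ℝ)))
        + ((ℓ : ℝ) + 1) * (f x *
          Matrix.det (Matrix.of fun r c => fderiv ℝ (μ r) x (v c)))) := by
  have hμd : ∀ r, DifferentiableAt ℝ (μ r) x := fun r => (hμ r).differentiableAt (by norm_num)
  have key : ∀ i : Fin (ℓ + 1),
      fderiv ℝ (fun y => f y * whitneyForm μ y fun j => v (i.succAbove j)) x (v i) =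
      (ℓ.factorial : ℝ) * ∑ j : Fin (ℓ + 1), (-1 : ℝ) ^ (j : ℕ) *
        (μ j x * (fderiv ℝ f x (v i) * Matrix.det (Matrix.of fun r c : Fin ℓ =>
            fderiv ℝ (μ (j.succAbove r)) x (v (i.succAbove c))))
        + f x * (fderiv ℝ (μ j) x (v i) * Matrix.det (Matrix.of fun r c : Fin ℓ =>
            fderiv ℝ (μ (j.succAbove r)) x (v (i.succAbove c))))
        + f x * μ j x * fderiv ℝ (fun y => Matrix.det (Matrix.of fun r c : Fin ℓ =>
            fderiv ℝ (μ (j.succAbove r)) y (v (i.succAbove c)))) x (v i)) := by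
    intro i
    have hd : ∀ j : Fin (ℓ + 1), HasFDerivAt (fun y => Matrix.det (Matrix.of fun r c : Fin ℓ =>
            fderiv ℝ (μ (j.succAbove r)) y (v (i.succAbove c)))) _ x := fun j =>
      (differentiableAt_detd (fun r => μ (j.succAbove r)) x (fun r => hμ _)
        (fun c => v (i.succAbove c))).hasFDerivAt
    have h1 := hf.hasFDerivAt.mul ((HasFDerivAt.fun_sum (u := Finset.univ) fun j _ =>
      (((hμd j).hasFDerivAt.const_mul ((-1 : ℝ) ^ (j : ℕ))).mul (hd j))).const_mul
        (ℓ.factorial : ℝ))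
    have h2 : HasFDerivAt (fun y => f y * whitneyForm μ y fun j => v (i.succAbove j)) _ x := h1
    rw [h2.fderiv]
    simp only [add_apply, smul_apply, smul_eq_mul,
      sum_apply, Finset.mul_sum, Finset.sum_mul, ← Finset.sum_add_distrib]
    refine Finset.sum_congr rfl fun j _ => ?_
    simp only [Pi.mul_apply]
    ring
  unfold extDerivAt
  simp only [key]
  simp only [Finset.mul_sum, mul_add]
  rw [Finset.sum_comm]
  simp only [Finset.sum_add_distrib]
  have e1 : ∀ j : Fin (ℓ + 1), ∑ i : Fin (ℓ + 1), (-1 : ℝ) ^ (i : ℕ) * ((ℓ.factorial : ℝ) *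
      ((-1 : ℝ) ^ (j : ℕ) * (μ j x * (fderiv ℝ f x (v i) * Matrix.det (Matrix.of fun r c : Fin ℓ =>
            fderiv ℝ (μ (j.succAbove r)) x (v (i.succAbove c))))))) =
      (ℓ.factorial : ℝ) * ((-1 : ℝ) ^ (j : ℕ) * (μ j x *
        Matrix.det (Matrix.of (Fin.cons (fun c => fderiv ℝ f x (v c))
          (fun r c => fderiv ℝ (μ (j.succAbove r)) x (v c)) :
            Fin (ℓ + 1) → Fin (ℓ + 1) → ℝ)))) := by
    intro j
    rw [← laplace]
    simp only [Finset.mul_sum]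
    exact Finset.sum_congr rfl fun i _ => by ring
  have e2 : ∀ j : Fin (ℓ + 1), ∑ i : Fin (ℓ + 1), (-1 : ℝ) ^ (i : ℕ) * ((ℓ.factorial : ℝ) *
      ((-1 : ℝ) ^ (j : ℕ) * (f x * (fderiv ℝ (μ j) x (v i) * Matrix.det
        (Matrix.of fun r c : Fin ℓ =>
            fderiv ℝ (μ (j.succAbove r)) x (v (i.succAbove c))))))) =
      (ℓ.factorial : ℝ) * (f x * Matrix.det (Matrix.of fun r c => fderiv ℝ (μ r) x (v c))) := by
    intro j
    have h := det_cons_row (fun r c => fderiv ℝ (μ r) x (v c)) j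
    rw [← laplace] at h
    have hj : ((-1 : ℝ) ^ (j : ℕ)) * (-1) ^ (j : ℕ) = 1 := by
      rw [← mul_pow]; simp
    calc _ = (ℓ.factorial : ℝ) * (f x * ((-1 : ℝ) ^ (j : ℕ) * ∑ i : Fin (ℓ + 1),
          (-1 : ℝ) ^ (i : ℕ) * (fderiv ℝ (μ j) x (v i) * Matrix.det
            (Matrix.of fun r c : Fin ℓ =>
              fderiv ℝ (μ (j.succAbove r)) x (v (i.succAbove c)))))) := by
            simp only [Finset.mul_sum]
            exact Finset.sum_congr rfl fun i _ => by ring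
      _ = _ := by rw [h, ← mul_assoc ((-1 : ℝ) ^ (j : ℕ)), hj, one_mul]
  have e3 : ∀ j : Fin (ℓ + 1), ∑ i : Fin (ℓ + 1), (-1 : ℝ) ^ (i : ℕ) * ((ℓ.factorial : ℝ) *
      ((-1 : ℝ) ^ (j : ℕ) * (f x * μ j x * fderiv ℝ (fun y => Matrix.det
        (Matrix.of fun r c : Fin ℓ =>
            fderiv ℝ (μ (j.succAbove r)) y (v (i.succAbove c)))) x (v i)))) = 0 := by
    intro j
    have h := sum_fderiv_det_eq_zero (fun r => μ (j.succAbove r)) x (fun r => hμ _) v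
    calc _ = (ℓ.factorial : ℝ) * ((-1 : ℝ) ^ (j : ℕ) * (f x * μ j x * ∑ i : Fin (ℓ + 1),
          (-1 : ℝ) ^ (i : ℕ) * fderiv ℝ (fun y => Matrix.det
        (Matrix.of fun r c : Fin ℓ =>
            fderiv ℝ (μ (j.succAbove r)) y (v (i.succAbove c)))) x (v i))) := by
            simp only [Finset.mul_sum]
            exact Finset.sum_congr rfl fun i _ => by ring
      _ = 0 := by rw [h]; simp
  simp only [e1, e2, e3]
  simp only [Finset.sum_const, Finset.card_univ, Fintype.card_fin, nsmul_eq_mul]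
  push_cast
  simp only [mul_zero, add_zero]
  ring

/-- Lemma `satrapaz`: on a `p`-simplex `σ` (`p = ℓ + m + 1`) with
barycentric coordinates `λ_0,…,λ_p` (smooth functions summing to `1` on an open set),
with `γ` the face spanned by `λ_0,…,λ_ℓ` and `φ_h` (for `h = ℓ+1,…,p`) the face spanned
by `λ_0,…,λ_ℓ,λ_h`, and `E` a smooth function of the barycentric coordinates, one has
`d(E·ω(γ;σ)) = (-1)^{ℓ+1} Σ_h ( E + (1/(ℓ+1)) ( Σ_i λ_i ∂E/∂λ_i − ∂E/∂λ_h ) ) ω(φ_h;σ)`. -/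
theorem extDeriv_smul_whitneyFaceExt {ℓ m : ℕ} (lam : Fin (ℓ + m + 2) → E → ℝ)
    (s : Set E) (hs : IsOpen s) (hsmooth : ∀ i, ContDiffOn ℝ (⊤ : ℕ∞) (lam i) s)
    (hsum : ∀ y ∈ s, ∑ i, lam i y = 1)
    (F : (Fin (ℓ + m + 2) → ℝ) → ℝ) (hF : ContDiff ℝ (⊤ : ℕ∞) F)
    (x : E) (hx : x ∈ s) (v : Fin (ℓ + 1) → E) :
    extDerivAt
      (fun y w =>
        F (fun i => lam i y) *
          whitneyForm (fun i : Fin (ℓ + 1) => lam (Fin.castLE (by omega) i)) y w)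
      x v =
    (-1 : ℝ) ^ (ℓ + 1) *
      ∑ h : Fin (m + 1),
        (F (fun i => lam i x) +
            ((ℓ : ℝ) + 1)⁻¹ *
              ((∑ i : Fin (ℓ + m + 2),
                  lam i x * fderiv ℝ F (fun i' => lam i' x) (Pi.single i 1)) -
                fderiv ℝ F (fun i' => lam i' x)
                  (Pi.single ⟨ℓ + 1 + (h : ℕ), by have := h.isLt; omega⟩ 1))) *
          whitneyForm
            (Fin.snoc (fun i : Fin (ℓ + 1) => lam (Fin.castLE (by omega) i))
              (lam ⟨ℓ + 1 + (h : ℕ), by have := h.isLt; omega⟩))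
            x v := by
  have hC : ∀ i, ContDiffAt ℝ 2 (lam i) x := fun i =>
    ((hsmooth i).contDiffAt (hs.mem_nhds hx)).of_le (WithTop.coe_le_coe.2 (le_top : (2 : ℕ∞) ≤ ⊤))
  have hD : ∀ i, DifferentiableAt ℝ (lam i) x := fun i => (hC i).differentiableAt (by norm_num)
  have hFd : DifferentiableAt ℝ F (fun i => lam i x) :=
    hF.contDiffAt.differentiableAt (by simp)
  have hcomp : HasFDerivAt (fun y => F (fun i => lam i y))
      ((fderiv ℝ F (fun i => lam i x)).comp
        (ContinuousLinearMap.pi fun i => fderiv ℝ (lam i) x)) x :=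
    hFd.hasFDerivAt.comp x (hasFDerivAt_pi.2 fun i => (hD i).hasFDerivAt)
  set P : Fin (ℓ + m + 2) → ℝ := fun i => fderiv ℝ F (fun i' => lam i' x) (Pi.single i 1) with hP
  have hdF : ∀ u, fderiv ℝ (fun y => F (fun i => lam i y)) x u =
      ∑ i, P i * fderiv ℝ (lam i) x u := by
    intro u
    rw [hcomp.fderiv]
    simp only [ContinuousLinearMap.comp_apply, hP]
    conv_lhs => rw [← Finset.univ_sum_single ((ContinuousLinearMap.pi
      fun i => fderiv ℝ (lam i) x) u), map_sum]
    refine Finset.sum_congr rfl fun i _ => ?_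
    rw [ContinuousLinearMap.pi_apply, mul_comm, ← smul_eq_mul, ← map_smul]
    congr 1
    ext k
    simp [Pi.single_apply]
  have hsum0 : ∀ u, ∑ i, fderiv ℝ (lam i) x u = 0 := by
    intro u
    have h1 : HasFDerivAt (fun y => ∑ i, lam i y) (∑ i, fderiv ℝ (lam i) x) x :=
      HasFDerivAt.fun_sum fun i _ => (hD i).hasFDerivAt
    have h2 : (fun y => ∑ i, lam i y) =ᶠ[nhds x] fun _ => (1 : ℝ) := by
      filter_upwards [hs.mem_nhds hx] with y hy using hsum y hy
    have h3 := h1.unique ((hasFDerivAt_const (1 : ℝ) x).congr_of_eventuallyEq h2)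
    have := congrArg (fun L => L u) h3
    simpa using this
  rw [extDerivAt_smul_whitney _ _ x (fun r => hC _) hcomp.differentiableAt]
  simp only [whitney_snoc]
  set μ : Fin (ℓ + 1) → E → ℝ := fun i => lam (Fin.castLE (by omega) i) with hμ
  set T := topRow (fun j => (Fin.cons (μ j x)
        (fun c => fderiv ℝ (μ j) x (v c)) : Fin (ℓ + 2) → ℝ)) with hT
  set R : Fin (ℓ + m + 2) → Fin (ℓ + 2) → ℝ := fun i =>
    Fin.cons (lam i x) (fun c => fderiv ℝ (lam i) x (v c)) with hR
  set S : ℝ := ∑ i, lam i x * P i with hS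
  set vol : ℝ := Matrix.det (Matrix.of fun r c => fderiv ℝ (μ r) x (v c)) with hvol
  -- split of sums over all indices
  have hsplit : ∀ G : Fin (ℓ + m + 2) → ℝ, (∑ i, G i * T (R i)) =
      ∑ h : Fin (m + 1), G ⟨ℓ + 1 + (h : ℕ), by have := h.isLt; omega⟩ *
        T (R ⟨ℓ + 1 + (h : ℕ), by have := h.isLt; omega⟩) := by
    intro G
    have e : (ℓ + 1) + (m + 1) = ℓ + m + 2 := by omega
    rw [← (finCongr e).sum_comp, Fin.sum_univ_add]
    have hz : ∀ i : Fin (ℓ + 1), T (R (finCongr e (Fin.castAdd (m + 1) i))) = 0 := fun i =>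
      topRow_row (fun j => (Fin.cons (μ j x)
        (fun c => fderiv ℝ (μ j) x (v c)) : Fin (ℓ + 2) → ℝ)) i
    simp only [hz, mul_zero, Finset.sum_const_zero, zero_add]
    rfl
  have hTcons : ∀ c α, T (Fin.cons c α) = c * vol - ∑ j : Fin (ℓ + 1), (-1 : ℝ) ^ (j : ℕ) * (μ j x *
        Matrix.det (Matrix.of (Fin.cons α (fun r c => fderiv ℝ (μ (j.succAbove r)) x (v c)) :
          Fin (ℓ + 1) → Fin (ℓ + 1) → ℝ))) := fun c α =>
    topRow_cons (fun j => μ j x) (fun j c => fderiv ℝ (μ j) x (v c)) c α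
  have hlin : ∀ G : Fin (ℓ + m + 2) → ℝ, (∑ i, G i * T (R i)) =
      T (Fin.cons (∑ i, lam i x * G i) (fun c => ∑ i, G i * fderiv ℝ (lam i) x (v c))) := by
    intro G
    simp only [← smul_eq_mul (a := G _), ← map_smul, ← map_sum]
    congr 1
    ext k
    refine Fin.cases ?_ (fun k => ?_) k
    · simp [hR, Finset.sum_apply, mul_comm]
    · simp [hR, Finset.sum_apply]
  have hone : (∑ i, T (R i)) = vol := by
    have h := hlin (fun _ => 1)
    simp only [one_mul, mul_one, hsum x hx, hsum0] at h
    rw [h, hTcons]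
    have hz : ∀ j : Fin (ℓ + 1), Matrix.det (Matrix.of (Fin.cons (fun _ => (0 : ℝ))
        (fun r c => fderiv ℝ (μ (j.succAbove r)) x (v c)) :
          Fin (ℓ + 1) → Fin (ℓ + 1) → ℝ)) = 0 := fun j =>
      Matrix.det_eq_zero_of_row_eq_zero 0 (fun _ => rfl)
    simp [hz]
  have hW := hlin P
  rw [hTcons] at hW
  simp only [← hdF] at hW
  have hsgn : ((-1 : ℝ) ^ (ℓ + 1)) * (-1) ^ (ℓ + 1) = 1 := by
    rw [← mul_pow]; simp
  have hl : ((ℓ : ℝ) + 1) ≠ 0 := by positivity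
  have hfin := hsplit (fun i => F (fun i => lam i x) + ((ℓ : ℝ) + 1)⁻¹ * (S - P i))
  have hexp : (∑ i, (F (fun i => lam i x) + ((ℓ : ℝ) + 1)⁻¹ * (S - P i)) * T (R i)) =
      (F (fun i => lam i x) + ((ℓ : ℝ) + 1)⁻¹ * S) * vol
        - ((ℓ : ℝ) + 1)⁻¹ * ∑ i, P i * T (R i) := by
    clear_value S
    rw [← hone, Finset.mul_sum, Finset.mul_sum, ← Finset.sum_sub_distrib]
    exact Finset.sum_congr rfl fun i _ => by ring
  calc _ = ((ℓ + 1).factorial : ℝ) *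
        ∑ i, (F (fun i => lam i x) + ((ℓ : ℝ) + 1)⁻¹ * (S - P i)) * T (R i) := by
        rw [hexp, hW, Nat.factorial_succ]
        push_cast
        field_simp
        ring
    _ = _ := by
        rw [hfin, Finset.mul_sum, Finset.mul_sum]
        refine Finset.sum_congr rfl fun h _ => ?_
        linear_combination (-((ℓ + 1).factorial : ℝ) *
          ((F (fun i => lam i x) + ((ℓ : ℝ) + 1)⁻¹ *
            (S - P ⟨ℓ + 1 + (h : ℕ), by have := h.isLt; omega⟩)) *
            T (R ⟨ℓ + 1 + (h : ℕ), by have := h.isLt; omega⟩))) * hsgn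
end

section
/- (Pullback of the Whitney form under the prism parametrization, case s = 1, σ = joint of σ_0 and σ_1.) Let λ_{0,0},…,λ_{0,α_0}, λ_{1,0},…,λ_{1,α_1} be the barycentric coordinates of a p-simplex σ (p = α_0 + α_1 + 1), and let ψ: τ × σ_0 × σ_1 → σ be given by λ_{0,i} = t_0 μ_{0,i}, λ_{1,i} = t_1 μ_{1,i} with t_0 + t_1 = 1. Then ψ*(ω(σ)) = (-1)^{α_0} · (p!/(α_0! α_1!)) · t_0^{α_0} t_1^{α_1} · ω(τ) ∧ ω(σ_0) ∧ ω(σ_1), where ω denotes the respective Whitney forms and the orientation of σ is the one induced by the given order of the coordinates. -/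
open scoped BigOperators

variable {E : Type*} [NormedAddCommGroup E] [NormedSpace ℝ E]

/-- Wedge product of two concrete alternating forms. -/
noncomputable def wedgeForm {k l : ℕ} (a : (Fin k → E) → ℝ) (b : (Fin l → E) → ℝ)
    (v : Fin (k + l) → E) : ℝ :=
  ((Nat.factorial k : ℝ) * (Nat.factorial l : ℝ))⁻¹ *
    ∑ σ : Equiv.Perm (Fin (k + l)),
      ((Equiv.Perm.sign σ : ℤ) : ℝ) *
        (a fun i => v (σ (Fin.castAdd l i))) * (b fun j => v (σ (Fin.natAdd k j)))

theorem wf_eq_det {E : Type*} [NormedAddCommGroup E] [NormedSpace ℝ E]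
    {p : ℕ} (lam : Fin (p + 1) → E → ℝ) (x : E) (i0 : Fin (p + 1))
    (h1 : ∑ i, lam i x = 1) (h0 : ∀ w, ∑ i, fderiv ℝ (lam i) x w = 0) :
    whitneyForm lam x = fun v : Fin p → E => ((Nat.factorial p : ℝ) * (-1) ^ (i0 : ℕ)) *
      Matrix.det (Matrix.of fun r c : Fin p => fderiv ℝ (lam (i0.succAbove r)) x (v c)) := by
  funext v
  let B : Matrix (Fin (p + 1)) (Fin (p + 1)) ℝ :=
    Matrix.of fun i => Fin.cons (lam i x) (fun c => fderiv ℝ (lam i) x (v c))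
  have e1 : whitneyForm lam x v = (Nat.factorial p : ℝ) * B.det := by
    rw [Matrix.det_succ_column_zero]
    rfl
  have e2 := Matrix.det_updateRow_sum B i0 (fun _ => (1 : ℝ))
  obtain ⟨R, hR⟩ : ∃ R : Fin (p + 1) → ℝ, R = ∑ k, (1 : ℝ) • B k := ⟨_, rfl⟩
  have hR0 : R 0 = 1 := by
    rw [hR]
    refine (Finset.sum_apply (0 : Fin (p + 1)) Finset.univ
      (fun k => ((1 : ℝ) • B k : Fin (p + 1) → ℝ))).trans ?_
    simpa [B] using h1
  have hRs : ∀ j : Fin p, R j.succ = 0 := by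
    intro j
    rw [hR]
    refine (Finset.sum_apply (j.succ : Fin (p + 1)) Finset.univ
      (fun k => ((1 : ℝ) • B k : Fin (p + 1) → ℝ))).trans ?_
    simpa [B] using h0 (v j)
  rw [one_smul, ← hR, Matrix.det_succ_row _ i0, Fin.sum_univ_succ] at e2
  simp only [Matrix.updateRow_self, hRs, hR0, mul_zero, zero_mul, Finset.sum_const_zero, add_zero,
    Fin.val_zero, mul_one, Matrix.submatrix_updateRow_succAbove] at e2
  rw [e1, ← e2, mul_assoc]
  rfl

theorem wedge_det {E : Type*} [NormedAddCommGroup E] [NormedSpace ℝ E]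
    {k l : ℕ} (f : Fin k → E → ℝ) (g : Fin l → E → ℝ) (a b : ℝ) :
    wedgeForm (fun w => a * Matrix.det (Matrix.of fun r c => f r (w c)))
      (fun w => b * Matrix.det (Matrix.of fun r c => g r (w c))) =
    fun v : Fin (k + l) → E =>
      (a * b) * Matrix.det (Matrix.of fun r c => Fin.append f g r (v c)) := by
  funext v
  have key : ∀ (π : Equiv.Perm (Fin k)) (ρ : Equiv.Perm (Fin l)),
      ∑ σ : Equiv.Perm (Fin (k + l)), ((Equiv.Perm.sign σ : ℤ) : ℝ) *
        (((Equiv.Perm.sign π : ℤ) : ℝ) * ∏ i, f i (v (σ (Fin.castAdd l (π i))))) *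
        (((Equiv.Perm.sign ρ : ℤ) : ℝ) * ∏ i, g i (v (σ (Fin.natAdd k (ρ i))))) =
      Matrix.det (Matrix.of fun r c => Fin.append f g r (v c)) := by
    intro π ρ
    rw [← Matrix.det_transpose, Matrix.det_apply']
    let τ : Equiv.Perm (Fin (k + l)) := finSumFinEquiv.permCongr (Equiv.sumCongr π ρ)
    have hτ : (Equiv.Perm.sign τ) = Equiv.Perm.sign π * Equiv.Perm.sign ρ := by
      simp only [τ, Equiv.Perm.sign_permCongr]
      exact Equiv.Perm.sign_sumCongr π ρ
    have h1 : ∀ i, τ (Fin.castAdd l i) = Fin.castAdd l (π i) := by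
      intro i; simp [τ, Equiv.permCongr_apply]
    have h2 : ∀ i, τ (Fin.natAdd k i) = Fin.natAdd k (ρ i) := by
      intro i; simp [τ, Equiv.permCongr_apply]
    refine Fintype.sum_equiv (Equiv.mulRight τ) _ _ ?_
    intro σ
    rw [Fin.prod_univ_add]
    simp only [Equiv.coe_mulRight, Matrix.transpose_apply, Matrix.of_apply, Fin.append_left,
      Fin.append_right, Equiv.Perm.mul_apply, h1, h2, Equiv.Perm.sign_mul, hτ]
    push_cast
    ring
  have hk : (Nat.factorial k : ℝ) ≠ 0 := by positivity
  have hl : (Nat.factorial l : ℝ) ≠ 0 := by positivity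
  have tot : ∑ σ : Equiv.Perm (Fin (k + l)), ((Equiv.Perm.sign σ : ℤ) : ℝ) *
        (a * Matrix.det (Matrix.of fun r c => f r (v (σ (Fin.castAdd l c))))) *
        (b * Matrix.det (Matrix.of fun r c => g r (v (σ (Fin.natAdd k c))))) =
      (a * b) * ∑ π : Equiv.Perm (Fin k), ∑ ρ : Equiv.Perm (Fin l),
        ∑ σ : Equiv.Perm (Fin (k + l)), ((Equiv.Perm.sign σ : ℤ) : ℝ) *
        (((Equiv.Perm.sign π : ℤ) : ℝ) * ∏ i, f i (v (σ (Fin.castAdd l (π i))))) *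
        (((Equiv.Perm.sign ρ : ℤ) : ℝ) * ∏ i, g i (v (σ (Fin.natAdd k (ρ i))))) := by
    have sw : ∀ F : Equiv.Perm (Fin k) → Equiv.Perm (Fin l) → Equiv.Perm (Fin (k + l)) → ℝ,
        ∑ π, ∑ ρ, ∑ σ, F π ρ σ = ∑ σ, ∑ π, ∑ ρ, F π ρ σ := by
      intro F
      rw [Finset.sum_comm]
      rw [Finset.sum_congr rfl fun ρ _ => Finset.sum_comm]
      rw [Finset.sum_comm]
      exact Finset.sum_congr rfl fun σ _ => Finset.sum_comm
    rw [sw, Finset.mul_sum]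
    refine Finset.sum_congr rfl fun σ _ => ?_
    rw [← Matrix.det_transpose, ← Matrix.det_transpose (Matrix.of fun r c => g r _),
      Matrix.det_apply', Matrix.det_apply']
    simp only [Matrix.transpose_apply, Matrix.of_apply]
    have : ∀ (s : ℝ) (A : Equiv.Perm (Fin k) → ℝ) (B : Equiv.Perm (Fin l) → ℝ),
        s * (a * ∑ π, A π) * (b * ∑ ρ, B ρ) = a * b * ∑ π, ∑ ρ, s * A π * B ρ := by
      intro s A B
      have : ∑ π, ∑ ρ, s * A π * B ρ = s * ((∑ π, A π) * ∑ ρ, B ρ) := by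
        rw [Finset.sum_mul_sum, Finset.mul_sum]
        refine Finset.sum_congr rfl fun _ _ => ?_
        rw [Finset.mul_sum]
        exact Finset.sum_congr rfl fun _ _ => by ring
      rw [this]; ring
    exact this _ _ _
  unfold wedgeForm
  rw [tot]
  simp only [key]
  simp only [Finset.sum_const, Finset.card_univ, Fintype.card_perm, Fintype.card_fin, nsmul_eq_mul]
  field_simp

theorem sum_fderiv_zero {E : Type*} [NormedAddCommGroup E] [NormedSpace ℝ E]
    {n : ℕ} (f : Fin n → E → ℝ) (s : Set E) (hs : IsOpen s) (x : E) (hx : x ∈ s)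
    (hd : ∀ i, DifferentiableAt ℝ (f i) x) (h : ∀ y ∈ s, ∑ i, f i y = 1) (w : E) :
    ∑ i, fderiv ℝ (f i) x w = 0 := by
  have h1 : fderiv ℝ (fun y => ∑ i, f i y) x = ∑ i, fderiv ℝ (f i) x :=
    fderiv_fun_sum fun i _ => hd i
  have h2 : (fun y => ∑ i, f i y) =ᶠ[nhds x] fun _ => (1 : ℝ) := by
    filter_upwards [hs.mem_nhds hx] with y hy using h y hy
  rw [h2.fderiv_eq] at h1
  have := congrArg (fun L : E →L[ℝ] ℝ => L w) h1
  simpa using this.symm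

/-- The determinant computation. -/
theorem det_join {a b : ℕ} {n : Type*} (T0 T1 : ℝ) (m0 : Fin (a + 1) → ℝ) (m1 : Fin b → ℝ)
    (dt : n → ℝ)
    (d0 : Fin (a + 1) → n → ℝ) (d1 : Fin b → n → ℝ)
    (hm : ∑ i, m0 i = 1) (hd : ∀ c, ∑ i, d0 i c = 0) (c : Fin (1 + a + b) → n) :
    Matrix.det (Matrix.of fun r q : Fin (1 + a + b) =>
      Fin.append (Fin.append (fun _ : Fin 1 => fun z => T0 * d0 0 z + m0 0 * dt z)
        (fun i : Fin a => fun z => T0 * d0 i.succ z + m0 i.succ * dt z))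
        (fun j : Fin b => fun z => T1 * d1 j z - m1 j * dt z) r (c q)) =
    T0 ^ a * T1 ^ b * Matrix.det (Matrix.of fun r q : Fin (1 + a + b) =>
      Fin.append (Fin.append (fun _ : Fin 1 => dt) (fun i : Fin a => d0 i.succ)) d1 r (c q)) := by
  set M : Matrix (Fin (1 + a + b)) (Fin (1 + a + b)) ℝ := Matrix.of fun r q =>
      Fin.append (Fin.append (fun _ : Fin 1 => fun z => T0 * d0 0 z + m0 0 * dt z)
        (fun i : Fin a => fun z => T0 * d0 i.succ z + m0 i.succ * dt z))
        (fun j : Fin b => fun z => T1 * d1 j z - m1 j * dt z) r (c q) with hM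
  set N : Matrix (Fin (1 + a + b)) (Fin (1 + a + b)) ℝ := Matrix.of fun r q =>
      Fin.append (Fin.append (fun _ : Fin 1 => dt) (fun i : Fin a => d0 i.succ)) d1 r (c q) with hN
  let k0 : Fin (1 + a + b) := Fin.castAdd b (Fin.castAdd a 0)
  let u : Fin (1 + a + b) → ℝ := Fin.append (Fin.append (fun _ : Fin 1 => 1) (fun _ : Fin a => 1))
    (fun _ : Fin b => 0)
  have e1 := Matrix.det_updateRow_sum M k0 u
  have hu : u k0 = 1 := by simp [u, k0]
  rw [hu, one_smul] at e1
  have hrow : (∑ k, u k • M k) = fun q => dt (c q) := by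
    funext q
    rw [Fin.sum_univ_add, Fin.sum_univ_add]
    simp only [u, Fin.append_left, Fin.append_right, Finset.sum_apply, Pi.add_apply, M,
      Pi.smul_apply, Matrix.of_apply]
    simp only [one_smul, zero_smul, Finset.sum_const_zero, add_zero, Finset.univ_unique,
      Finset.sum_singleton]
    have e := Fin.sum_univ_succ (fun i => T0 * d0 i (c q) + m0 i * dt (c q))
    rw [Finset.sum_add_distrib, ← Finset.mul_sum, ← Finset.sum_mul, hm, hd] at e
    linarith
  rw [hrow] at e1
  let sc : Fin (1 + a + b) → ℝ := Fin.append (Fin.append (fun _ : Fin 1 => 1) (fun _ : Fin a => T0))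
    (fun _ : Fin b => T1)
  let cf : Fin (1 + a + b) → ℝ :=
    Fin.append (Fin.append (fun _ : Fin 1 => 0) (fun i : Fin a => m0 i.succ)) (fun j => - m1 j)
  have e2 := Matrix.det_mul_column sc N
  have hsc : ∏ i, sc i = T0 ^ a * T1 ^ b := by
    rw [Fin.prod_univ_add, Fin.prod_univ_add]
    simp [sc]
  rw [hsc] at e2
  rw [← e1, ← e2]
  refine Matrix.det_eq_of_forall_row_eq_smul_add_const cf k0 (by simp [cf, k0]) ?_
  intro r q
  have hk : (Matrix.of fun i j => sc i * N i j) k0 q = dt (c q) := by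
    simp [sc, k0, N]
  rw [hk]
  refine Fin.addCases (fun r => ?_) (fun j => ?_) r
  · refine Fin.addCases (fun z => ?_) (fun i => ?_) r
    · have hz : z = 0 := Subsingleton.elim _ _
      subst hz
      rw [Matrix.updateRow_self]
      simp [sc, cf, N]
    · rw [Matrix.updateRow_ne (by simp [k0, Fin.ext_iff])]
      simp [sc, cf, N, M]
  · rw [Matrix.updateRow_ne (by simp [k0, Fin.ext_iff])]
    simp [sc, cf, N, M]
    ring

/-- pullback of the Whitney form, case `s = 1`: with `t_0 + t_1 = 1`,
`Σ_i μ_{0,i} = 1`, `Σ_i μ_{1,i} = 1` (smooth functions on an open set), and the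
composite barycentric coordinates `λ_{0,i} = t_0 μ_{0,i}`, `λ_{1,i} = t_1 μ_{1,i}`
of the join `σ = σ_0 * σ_1` (`p = α_0 + α_1 + 1`), one has
`ψ*(ω(σ)) = (-1)^{α_0} (p!/(α_0! α_1!)) t_0^{α_0} t_1^{α_1} ω(τ) ∧ ω(σ_0) ∧ ω(σ_1)`. -/
theorem whitneyForm_pullback_join {α₀ α₁ : ℕ} (t0 t1 : E → ℝ)
    (mu0 : Fin (α₀ + 1) → E → ℝ) (mu1 : Fin (α₁ + 1) → E → ℝ) (s : Set E)
    (hs : IsOpen s) (ht0 : ContDiffOn ℝ (⊤ : ℕ∞) t0 s) (ht1 : ContDiffOn ℝ (⊤ : ℕ∞) t1 s)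
    (hmu0 : ∀ i, ContDiffOn ℝ (⊤ : ℕ∞) (mu0 i) s) (hmu1 : ∀ i, ContDiffOn ℝ (⊤ : ℕ∞) (mu1 i) s)
    (hsumt : ∀ y ∈ s, t0 y + t1 y = 1)
    (hsum0 : ∀ y ∈ s, ∑ i, mu0 i y = 1) (hsum1 : ∀ y ∈ s, ∑ i, mu1 i y = 1)
    (x : E) (hx : x ∈ s) (v : Fin (1 + α₀ + α₁) → E) :
    whitneyForm
      (fun k : Fin (1 + α₀ + α₁ + 1) =>
        if h : (k : ℕ) ≤ α₀ then
          fun y => t0 y * mu0 ⟨(k : ℕ), by omega⟩ y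
        else
          fun y => t1 y * mu1 ⟨(k : ℕ) - (α₀ + 1), by have := k.isLt; omega⟩ y)
      x v =
    (-1 : ℝ) ^ α₀ *
      ((Nat.factorial (α₀ + α₁ + 1) : ℝ) /
        ((Nat.factorial α₀ : ℝ) * (Nat.factorial α₁ : ℝ))) *
      t0 x ^ α₀ * t1 x ^ α₁ *
      wedgeForm (wedgeForm (whitneyForm ![t0, t1] x) (whitneyForm mu0 x))
        (whitneyForm mu1 x) v := by
  have dt0 : DifferentiableAt ℝ t0 x := (ht0.contDiffAt (hs.mem_nhds hx)).differentiableAt (by simp)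
  have dt1 : DifferentiableAt ℝ t1 x := (ht1.contDiffAt (hs.mem_nhds hx)).differentiableAt (by simp)
  have dm0 : ∀ i, DifferentiableAt ℝ (mu0 i) x := fun i =>
    ((hmu0 i).contDiffAt (hs.mem_nhds hx)).differentiableAt (by simp)
  have dm1 : ∀ i, DifferentiableAt ℝ (mu1 i) x := fun i =>
    ((hmu1 i).contDiffAt (hs.mem_nhds hx)).differentiableAt (by simp)
  have s0 := sum_fderiv_zero mu0 s hs x hx dm0 hsum0
  have s1 := sum_fderiv_zero mu1 s hs x hx dm1 hsum1
  have hst : ∀ y ∈ s, ∑ i, (![t0, t1] : Fin 2 → E → ℝ) i y = 1 := by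
    intro y hy; simpa [Fin.sum_univ_two] using hsumt y hy
  have st := sum_fderiv_zero ![t0, t1] s hs x hx
    (by intro i; fin_cases i <;> simpa) hst
  have st' : ∀ w, fderiv ℝ t1 x w = - fderiv ℝ t0 x w := by
    intro w
    have := st w
    simp [Fin.sum_univ_two] at this
    linarith
  rw [wf_eq_det mu0 x 0 (hsum0 x hx) s0, wf_eq_det mu1 x 0 (hsum1 x hx) s1,
    wf_eq_det (p := 1) ![t0, t1] x 1 (hst x hx) st,
    wedge_det (fun r w => fderiv ℝ ((![t0, t1] : Fin 2 → E → ℝ) (Fin.succAbove 1 r)) x w)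
      (fun r w => fderiv ℝ (mu0 (Fin.succAbove 0 r)) x w),
    wedge_det _ (fun r w => fderiv ℝ (mu1 (Fin.succAbove 0 r)) x w)]
  set lam : Fin (1 + α₀ + α₁ + 1) → E → ℝ := (fun k : Fin (1 + α₀ + α₁ + 1) =>
        if h : (k : ℕ) ≤ α₀ then
          fun y => t0 y * mu0 ⟨(k : ℕ), by omega⟩ y
        else
          fun y => t1 y * mu1 ⟨(k : ℕ) - (α₀ + 1), by have := k.isLt; omega⟩ y) with hlam
  have L0 : ∀ (k : Fin (1 + α₀ + α₁ + 1)) (i : Fin (α₀ + 1)), (k : ℕ) = i →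
      lam k = fun y => t0 y * mu0 i y := by
    intro k i h
    have : (k : ℕ) ≤ α₀ := by omega
    simp only [hlam, this, dif_pos]
    have : (⟨(k : ℕ), by omega⟩ : Fin (α₀ + 1)) = i := Fin.ext h
    rw [this]
  have L1 : ∀ (k : Fin (1 + α₀ + α₁ + 1)) (i : Fin (α₁ + 1)), (k : ℕ) = α₀ + 1 + i →
      lam k = fun y => t1 y * mu1 i y := by
    intro k i h
    have h' : ¬ (k : ℕ) ≤ α₀ := by omega
    simp only [hlam, h', dif_neg, not_false_eq_true]
    have : (⟨(k : ℕ) - (α₀ + 1), by omega⟩ : Fin (α₁ + 1)) = i := Fin.ext (by simp; omega)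
    rw [this]
  have dlam : ∀ k, DifferentiableAt ℝ (lam k) x := by
    intro k
    by_cases h : (k : ℕ) ≤ α₀
    · rw [L0 k ⟨k, by omega⟩ rfl]; exact dt0.mul (dm0 _)
    · rw [L1 k ⟨k - (α₀ + 1), by omega⟩ (by simp; omega)]; exact dt1.mul (dm1 _)
  have hsl : ∀ y ∈ s, ∑ k, lam k y = 1 := by
    intro y hy
    have hc : (α₀ + 1) + (α₁ + 1) = 1 + α₀ + α₁ + 1 := by omega
    rw [← Fintype.sum_equiv (finCongr hc) (fun k => lam (finCongr hc k) y) _ (fun _ => rfl),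
      Fin.sum_univ_add]
    rw [Finset.sum_congr rfl fun i _ => congrFun (L0 (finCongr hc (Fin.castAdd _ i)) i (by simp)) y,
      Finset.sum_congr rfl fun i _ => congrFun (L1 (finCongr hc (Fin.natAdd _ i)) i (by simp; try omega)) y,
      ← Finset.mul_sum, ← Finset.mul_sum, hsum0 y hy, hsum1 y hy, mul_one, mul_one, hsumt y hy]
  let k1 : Fin (1 + α₀ + α₁ + 1) := ⟨α₀ + 1, by omega⟩
  rw [wf_eq_det lam x k1 (hsl x hx) (sum_fderiv_zero lam s hs x hx dlam hsl)]
  have key := det_join (n := E) (t0 x) (t1 x) (fun i => mu0 i x) (fun j : Fin α₁ => mu1 j.succ x)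
    (fun w => fderiv ℝ t0 x w) (fun i w => fderiv ℝ (mu0 i) x w)
    (fun j w => fderiv ℝ (mu1 j.succ) x w) (hsum0 x hx) s0 v
  have F0 : ∀ i w, fderiv ℝ (fun y => t0 y * mu0 i y) x w =
      t0 x * fderiv ℝ (mu0 i) x w + mu0 i x * fderiv ℝ t0 x w := by
    intro i w
    rw [fderiv_fun_mul dt0 (dm0 i)]; simp
  have F1 : ∀ i w, fderiv ℝ (fun y => t1 y * mu1 i y) x w =
      t1 x * fderiv ℝ (mu1 i) x w - mu1 i x * fderiv ℝ t0 x w := by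
    intro i w
    rw [fderiv_fun_mul dt1 (dm1 i)]; simp [st']; ring
  have hleft : (Matrix.of fun r c => fderiv ℝ (lam (k1.succAbove r)) x (v c)) =
      (Matrix.of fun r q : Fin (1 + α₀ + α₁) =>
      Fin.append (Fin.append (fun _ : Fin 1 => fun z => t0 x * fderiv ℝ (mu0 0) x z
          + mu0 0 x * fderiv ℝ t0 x z)
        (fun i : Fin α₀ => fun z => t0 x * fderiv ℝ (mu0 i.succ) x z
          + mu0 i.succ x * fderiv ℝ t0 x z))
        (fun j : Fin α₁ => fun z => t1 x * fderiv ℝ (mu1 j.succ) x z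
          - mu1 j.succ x * fderiv ℝ t0 x z) r (v q)) := by
    ext r q
    simp only [Matrix.of_apply]
    refine Fin.addCases (fun r => ?_) (fun j => ?_) r
    · have hv : (k1.succAbove (Fin.castAdd α₁ r) : ℕ) = r := by
        rw [Fin.succAbove_of_castSucc_lt]
        · simp
        · simp [k1, Fin.lt_def]; omega
      rw [Fin.append_left]
      revert hv
      refine Fin.addCases (fun z => ?_) (fun i => ?_) r
      · intro hv
        rw [L0 _ 0 (by rw [hv]; simp), F0, Fin.append_left]
      · intro hv
        rw [L0 _ i.succ (by rw [hv]; simp; omega), F0, Fin.append_right]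
    · have hv : (k1.succAbove (Fin.natAdd (1 + α₀) j) : ℕ) = α₀ + 1 + j.succ := by
        rw [Fin.succAbove_of_le_castSucc]
        · simp; omega
        · simp [k1, Fin.le_def]; omega
      rw [Fin.append_right, L1 _ j.succ hv, F1]
  have hright : (Matrix.of fun r q : Fin (1 + α₀ + α₁) =>
      Fin.append (Fin.append (fun _ : Fin 1 => fun w => fderiv ℝ t0 x w)
        (fun i : Fin α₀ => fun w => fderiv ℝ (mu0 i.succ) x w))
        (fun j w => fderiv ℝ (mu1 j.succ) x w) r (v q)) =
      Matrix.of fun r c => Fin.append (Fin.append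
        (fun r w => fderiv ℝ ((![t0, t1] : Fin 2 → E → ℝ) (Fin.succAbove 1 r)) x w)
        (fun r w => fderiv ℝ (mu0 (Fin.succAbove 0 r)) x w))
        (fun r w => fderiv ℝ (mu1 (Fin.succAbove 0 r)) x w) r (v c) := by
    have : (fun (r : Fin 1) w => fderiv ℝ ((![t0, t1] : Fin 2 → E → ℝ) (Fin.succAbove 1 r)) x w)
        = fun _ => fun w => fderiv ℝ t0 x w := by
      funext r w
      have : r = 0 := Subsingleton.elim _ _
      subst this
      rfl
    rw [this]
    simp only [Fin.succAbove_zero]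
  beta_reduce
  rw [hleft, key, hright]
  have hp : 1 + α₀ + α₁ = α₀ + α₁ + 1 := by omega
  have h0 : (Nat.factorial α₀ : ℝ) ≠ 0 := by positivity
  have h1 : (Nat.factorial α₁ : ℝ) ≠ 0 := by positivity
  rw [show Nat.factorial (1 + α₀ + α₁) = Nat.factorial (α₀ + α₁ + 1) by rw [hp]]
  simp only [k1, Fin.val_zero, pow_zero, Nat.factorial_one, Nat.cast_one, Fin.val_one]
  field_simp
  try ring
end

section
/- (General pullback formula, Proposition IMINVE.) Let σ be the iterated join σ_0 * ⋯ * σ_s of simplexes over the simplex τ, p = dim σ, and ψ: τ × σ_0 × ⋯ × σ_s → σ the prism parametrization λ_{j,i} = t_j μ_{j,i}. Then ψ*(ω(σ)) = (-1)^{α(σ,ν)} · ( p! / (|σ_0|! ⋯ |σ_s|! · s!) ) · t_0^{|σ_0|} ⋯ t_s^{|σ_s|} · ω(τ) ∧ ω(σ_0) ∧ ⋯ ∧ ω(σ_s), where α(σ,ν) = s|σ_0| + (s−1)|σ_1| + ⋯ + |σ_{s−1}| + a(ν) and a(ν) is the sign of the permutation ν ordering the coordinates of σ by groups. -/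
open scoped BigOperators

variable {E : Type*} [NormedAddCommGroup E] [NormedSpace ℝ E]

/-- Position of the pair `(j, i)` in the concatenation of blocks of sizes `d 0, …`. -/
def sigmaIdx {n : ℕ} (d : Fin n → ℕ) (j : Fin n) (i : Fin (d j)) : Fin (∑ k, d k) :=
  ⟨(∑ k ∈ Finset.univ.filter fun k => k < j, d k) + (i : ℕ), by
    have hj : j ∉ Finset.univ.filter fun k => k < j := by simp
    have h1 : (∑ k ∈ Finset.univ.filter fun k => k < j, d k) + d j
        = ∑ k ∈ insert j (Finset.univ.filter fun k => k < j), d k := by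
      rw [Finset.sum_insert hj]; ring
    have h2 : ∑ k ∈ insert j (Finset.univ.filter fun k => k < j), d k ≤ ∑ k, d k :=
      Finset.sum_le_sum_of_subset (Finset.subset_univ _)
    have h3 : (i : ℕ) < d j := i.isLt
    omega⟩

/-- Wedge product of a family of concrete alternating forms of degrees `d j`. -/
noncomputable def bigWedge {n : ℕ} (d : Fin n → ℕ)
    (a : (j : Fin n) → (Fin (d j) → E) → ℝ) (v : Fin (∑ k, d k) → E) : ℝ :=
  (∏ j, (Nat.factorial (d j) : ℝ))⁻¹ *
    ∑ σ : Equiv.Perm (Fin (∑ k, d k)),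
      ((Equiv.Perm.sign σ : ℤ) : ℝ) * ∏ j, a j fun i => v (σ (sigmaIdx d j i))

section helpers

open Equiv

theorem wp_det_blockDiagonal {n : ℕ} (d : Fin n → ℕ)
    (P : (j : Fin n) → Matrix (Fin (d j)) (Fin (d j)) ℝ) :
    (Matrix.blockDiagonal' P).det = ∏ j, (P j).det := by
  have hb : (Matrix.blockDiagonal' P).BlockTriangular (fun x : (Σ j, Fin (d j)) => x.1) := by
    intro x y hxy
    obtain ⟨a, i⟩ := x
    obtain ⟨b, i'⟩ := y
    exact Matrix.blockDiagonal'_apply_ne P i i' (ne_of_gt hxy)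
  rw [hb.det_fintype]
  refine Finset.prod_congr rfl fun j _ => ?_
  rw [← Matrix.det_submatrix_equiv_self (Equiv.sigmaSubtype j).symm]
  congr 1
  ext a b
  exact Matrix.blockDiagonal'_apply_eq P j a b

theorem wp_sign_sigma {n : ℕ} (d : Fin n → ℕ) (F : (j : Fin n) → Perm (Fin (d j))) :
    Perm.sign (Perm.sigmaCongrRight F) = ∏ j, Perm.sign (F j) := by
  have h : (((Perm.sign (Perm.sigmaCongrRight F) : ℤ)) : ℝ)
      = ((∏ j, Perm.sign (F j) : ℤˣ) : ℤ) := by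
    rw [← Matrix.det_permutation]
    have : Perm.permMatrix ℝ (Perm.sigmaCongrRight F)
        = Matrix.blockDiagonal' fun j => Perm.permMatrix ℝ (F j) := by
      ext ⟨a, i⟩ ⟨b, k⟩
      by_cases hab : a = b
      · subst hab
        simp [PEquiv.toMatrix_apply, Matrix.blockDiagonal'_apply_eq]
      · rw [Matrix.blockDiagonal'_apply_ne _ _ _ hab]
        simp [PEquiv.toMatrix_apply, hab]
    rw [this, wp_det_blockDiagonal]
    push_cast
    simp [Matrix.det_permutation]
  apply Units.ext
  exact_mod_cast h

theorem wp_laplace_sigma {n m : ℕ} (d : Fin n → ℕ) (e : (Σ j, Fin (d j)) ≃ Fin m)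
    (A : Fin m → Fin m → ℝ) :
    ∑ σ : Perm (Fin m), ((Perm.sign σ : ℤ) : ℝ) *
      ∏ j, Matrix.det (Matrix.of fun r c : Fin (d j) => A (e ⟨j, r⟩) (σ (e ⟨j, c⟩)))
    = (∏ j, (Nat.factorial (d j) : ℝ)) * (Matrix.of A).det := by
  have h1 : ∀ σ : Perm (Fin m),
      ∏ j, Matrix.det (Matrix.of fun r c : Fin (d j) => A (e ⟨j, r⟩) (σ (e ⟨j, c⟩)))
      = ∑ F : (j : Fin n) → Perm (Fin (d j)), ∏ j, (((Perm.sign (F j) : ℤ) : ℝ) *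
        ∏ i, A (e ⟨j, i⟩) (σ (e ⟨j, F j i⟩))) := by
    intro σ
    have := (Finset.prod_univ_sum (fun j : Fin n => (Finset.univ : Finset (Perm (Fin (d j)))))
      (fun j (F : Perm (Fin (d j))) => ((Perm.sign F : ℤ) : ℝ) *
        ∏ i, A (e ⟨j, i⟩) (σ (e ⟨j, F i⟩))))
    rw [Fintype.piFinset_univ] at this
    rw [← this]
    refine Finset.prod_congr rfl fun j _ => ?_
    rw [← Matrix.det_transpose, Matrix.det_apply']
    rfl
  simp_rw [h1, Finset.mul_sum]
  rw [Finset.sum_comm]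
  have h2 : ∀ F : (j : Fin n) → Perm (Fin (d j)),
      ∑ σ : Perm (Fin m), ((Perm.sign σ : ℤ) : ℝ) * ∏ j, (((Perm.sign (F j) : ℤ) : ℝ) *
        ∏ i, A (e ⟨j, i⟩) (σ (e ⟨j, F j i⟩))) = (Matrix.of A).det := by
    intro F
    rw [← Matrix.det_transpose, Matrix.det_apply']
    refine Fintype.sum_equiv (Equiv.mulRight (e.permCongr (Perm.sigmaCongrRight F))) _ _ ?_
    intro σ
    rw [Finset.prod_mul_distrib]
    have hs : ((Perm.sign (e.permCongr (Perm.sigmaCongrRight F)) : ℤ) : ℝ)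
        = ∏ j, ((Perm.sign (F j) : ℤ) : ℝ) := by
      rw [Perm.sign_permCongr, wp_sign_sigma]
      push_cast
      rfl
    simp only [Equiv.coe_mulRight, Perm.sign_mul, Units.val_mul, Int.cast_mul, hs]
    rw [mul_assoc]
    congr 2
    rw [← Equiv.prod_comp e, Fintype.prod_sigma]
    simp [Matrix.transpose_apply, Equiv.permCongr_apply]
  simp_rw [h2]
  simp [Fintype.card_perm]

theorem wp_laplace_sum {k l : ℕ} (A : Fin (k + l) → Fin (k + l) → ℝ) :
    ∑ σ : Perm (Fin (k + l)), ((Perm.sign σ : ℤ) : ℝ) *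
      Matrix.det (Matrix.of fun r c : Fin k => A (Fin.castAdd l r) (σ (Fin.castAdd l c))) *
      Matrix.det (Matrix.of fun r c : Fin l => A (Fin.natAdd k r) (σ (Fin.natAdd k c)))
    = ((Nat.factorial k : ℝ) * (Nat.factorial l : ℝ)) * (Matrix.of A).det := by
  have h1 : ∀ σ : Perm (Fin (k + l)), ((Perm.sign σ : ℤ) : ℝ) *
      Matrix.det (Matrix.of fun r c : Fin k => A (Fin.castAdd l r) (σ (Fin.castAdd l c))) *
      Matrix.det (Matrix.of fun r c : Fin l => A (Fin.natAdd k r) (σ (Fin.natAdd k c)))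
      = ∑ F : Perm (Fin k) × Perm (Fin l), ((Perm.sign σ : ℤ) : ℝ) *
        ((((Perm.sign F.1 : ℤ) : ℝ) * ∏ i, A (Fin.castAdd l i) (σ (Fin.castAdd l (F.1 i)))) *
        (((Perm.sign F.2 : ℤ) : ℝ) * ∏ i, A (Fin.natAdd k i) (σ (Fin.natAdd k (F.2 i))))) := by
    intro σ
    rw [← Finset.mul_sum, mul_assoc, Fintype.sum_prod_type]
    dsimp only
    rw [← Finset.sum_mul_sum]
    rw [← Matrix.det_transpose, Matrix.det_apply']
    rw [← Matrix.det_transpose (Matrix.of fun r c : Fin l => _), Matrix.det_apply']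
    rfl
  simp_rw [h1]
  rw [Finset.sum_comm]
  have h2 : ∀ F : Perm (Fin k) × Perm (Fin l),
      ∑ σ : Perm (Fin (k + l)), ((Perm.sign σ : ℤ) : ℝ) *
        ((((Perm.sign F.1 : ℤ) : ℝ) * ∏ i, A (Fin.castAdd l i) (σ (Fin.castAdd l (F.1 i)))) *
        (((Perm.sign F.2 : ℤ) : ℝ) * ∏ i, A (Fin.natAdd k i) (σ (Fin.natAdd k (F.2 i)))))
       = (Matrix.of A).det := by
    intro F
    rw [← Matrix.det_transpose, Matrix.det_apply']
    refine Fintype.sum_equiv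
      (Equiv.mulRight (finSumFinEquiv.permCongr (Perm.sumCongr F.1 F.2))) _ _ ?_
    intro σ
    simp only [Equiv.coe_mulRight, Perm.sign_mul, Units.val_mul, Int.cast_mul,
      Perm.sign_permCongr, Perm.sign_sumCongr]
    rw [← Equiv.prod_comp finSumFinEquiv, Fintype.prod_sum_type]
    simp [Matrix.transpose_apply, Equiv.permCongr_apply]
    ring
  simp_rw [h2]
  simp [Fintype.card_perm]

/-- bordered determinant -/
theorem wp_bordered {p : ℕ} (a : Fin (p + 1) → ℝ) (D : Fin (p + 1) → Fin p → ℝ)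
    (c : Fin (p + 1) → ℝ) (hc : c 0 = 1) (ha : ∑ i, c i * a i = 1)
    (hD : ∀ k, ∑ i, c i * D i k = 0) :
    Matrix.det (Matrix.of fun i k : Fin (p + 1) => (Fin.cons (a i) (D i) : Fin (p + 1) → ℝ) k)
      = Matrix.det (Matrix.of fun r k : Fin p => D r.succ k) := by
  set M := (Matrix.of fun i k : Fin (p + 1) => (Fin.cons (a i) (D i) : Fin (p + 1) → ℝ) k)
    with hM
  have h := Matrix.det_updateRow_sum M 0 c
  rw [hc, one_smul] at h
  have h3 : (∑ k, c k • M k) = (Fin.cons 1 (fun _ => 0) : Fin (p + 1) → ℝ) := by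
    funext k
    simp only [Finset.sum_apply, Pi.smul_apply, smul_eq_mul]
    refine Fin.cases ?_ (fun k => ?_) k
    · simpa [hM] using ha
    · simpa [hM] using hD k
  rw [← h, h3, Matrix.det_succ_row_zero, Fin.sum_univ_succ]
  simp
  congr 1

theorem wp_whitney_det {E : Type*} [NormedAddCommGroup E] [NormedSpace ℝ E]
    {p : ℕ} (lam : Fin (p + 1) → E → ℝ) (x : E) (v : Fin p → E) :
    whitneyForm lam x v = (Nat.factorial p : ℝ) *
      Matrix.det (Matrix.of fun i k : Fin (p + 1) =>
        (Fin.cons (lam i x) (fun c => fderiv ℝ (lam i) x (v c)) : Fin (p + 1) → ℝ) k) := by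
  rw [whitneyForm, Matrix.det_succ_column_zero]
  rfl

theorem wp_sigmaIdx_lt {n : ℕ} (d : Fin n → ℕ) {j j' : Fin n} (i : Fin (d j)) (i' : Fin (d j'))
    (h : j < j') : sigmaIdx d j i < sigmaIdx d j' i' := by
  have hj : j ∉ Finset.univ.filter fun k => k < j := by simp
  have h2 : ∑ k ∈ insert j (Finset.univ.filter fun k => k < j), d k
      ≤ ∑ k ∈ Finset.univ.filter (fun k => k < j'), d k := by
    apply Finset.sum_le_sum_of_subset
    intro k hk
    simp only [Finset.mem_insert, Finset.mem_filter, Finset.mem_univ, true_and] at hk ⊢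
    rcases hk with rfl | hk
    · exact h
    · exact hk.trans h
  rw [Finset.sum_insert hj] at h2
  have h3 := i.isLt
  rw [Fin.lt_def]
  simp only [sigmaIdx]
  omega

theorem wp_sigmaIdx_lt_iff {n : ℕ} (d : Fin n → ℕ) {j : Fin n} (i i' : Fin (d j)) :
    sigmaIdx d j i < sigmaIdx d j i' ↔ i < i' := by
  rw [Fin.lt_def, Fin.lt_def]
  simp only [sigmaIdx]
  omega

theorem wp_sigmaIdx_bij {n : ℕ} (d : Fin n → ℕ) :
    Function.Bijective (fun y : (Σ j, Fin (d j)) => sigmaIdx d y.1 y.2) := by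
  rw [Fintype.bijective_iff_injective_and_card]
  refine ⟨?_, by simp⟩
  rintro ⟨j, i⟩ ⟨j', i'⟩ h
  rcases lt_trichotomy j j' with hj | rfl | hj
  · exact absurd h (wp_sigmaIdx_lt d i i' hj).ne
  · have : (i : ℕ) = i' := by
      have := congrArg Fin.val h
      simp only [sigmaIdx] at this
      omega
    rw [Fin.ext this]
  · exact absurd h (wp_sigmaIdx_lt d i' i hj).ne'

end helpers

section helpers2

open Equiv

/-- grouped order -/
noncomputable def wpG {s : ℕ} (α : Fin (s + 1) → ℕ)
    (hP : (∑ j, (α j + 1)) = (s + ∑ j, α j) + 1) :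
    (Σ j, Fin (α j + 1)) ≃ Fin ((s + ∑ j, α j) + 1) :=
  (Equiv.ofBijective _ (wp_sigmaIdx_bij (fun j => α j + 1))).trans (finCongr hP)

theorem wpG_apply {s : ℕ} (α : Fin (s + 1) → ℕ)
    (hP : (∑ j, (α j + 1)) = (s + ∑ j, α j) + 1) (j : Fin (s + 1)) (i : Fin (α j + 1)) :
    wpG α hP ⟨j, i⟩ = Fin.cast hP (sigmaIdx (fun j' => α j' + 1) j i) := rfl

/-- order in which the zeroth vertices come first -/
def wpHfun {s : ℕ} (α : Fin (s + 1) → ℕ) (y : Σ j, Fin (α j + 1)) :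
    Fin ((s + ∑ j, α j) + 1) :=
  Fin.cases (motive := fun _ => Fin ((s + ∑ j, α j) + 1))
    ⟨(y.1 : ℕ), by have := y.1.isLt; omega⟩
    (fun i => ⟨s + 1 + (sigmaIdx α y.1 i : ℕ), by have := (sigmaIdx α y.1 i).isLt; omega⟩) y.2

theorem wpHfun_zero {s : ℕ} (α : Fin (s + 1) → ℕ) (j : Fin (s + 1)) :
    (wpHfun α ⟨j, 0⟩ : ℕ) = j := rfl

theorem wpHfun_succ {s : ℕ} (α : Fin (s + 1) → ℕ) (j : Fin (s + 1)) (i : Fin (α j)) :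
    (wpHfun α ⟨j, i.succ⟩ : ℕ) = s + 1 + (sigmaIdx α j i : ℕ) := rfl

theorem wpHfun_bij {s : ℕ} (α : Fin (s + 1) → ℕ) : Function.Bijective (wpHfun α) := by
  rw [Fintype.bijective_iff_injective_and_card]
  refine ⟨?_, by simp [Finset.sum_add_distrib]; ring⟩
  rintro ⟨j, i⟩ ⟨j', i'⟩ h
  have h' := congrArg Fin.val h
  induction i using Fin.cases with
  | zero =>
    induction i' using Fin.cases with
    | zero =>
      rw [wpHfun_zero, wpHfun_zero] at h'
      have := Fin.ext h'
      subst this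
      rfl
    | succ i' =>
      rw [wpHfun_zero, wpHfun_succ] at h'
      omega
  | succ i =>
    induction i' using Fin.cases with
    | zero =>
      rw [wpHfun_zero, wpHfun_succ] at h'
      omega
    | succ i' =>
      rw [wpHfun_succ, wpHfun_succ] at h'
      have h2 : sigmaIdx α j i = sigmaIdx α j' i' := Fin.ext (by omega)
      have h3 := (wp_sigmaIdx_bij α).1 (a₁ := ⟨j, i⟩) (a₂ := ⟨j', i'⟩) h2
      cases h3
      rfl

/-- order in which the zeroth vertices come first, as an equivalence -/
noncomputable def wpH {s : ℕ} (α : Fin (s + 1) → ℕ) :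
    (Σ j, Fin (α j + 1)) ≃ Fin ((s + ∑ j, α j) + 1) :=
  Equiv.ofBijective _ (wpHfun_bij α)

theorem wpH_zero {s : ℕ} (α : Fin (s + 1) → ℕ) (j : Fin (s + 1)) :
    (wpH α ⟨j, 0⟩ : ℕ) = j := rfl

theorem wpH_succ {s : ℕ} (α : Fin (s + 1) → ℕ) (j : Fin (s + 1)) (i : Fin (α j)) :
    (wpH α ⟨j, i.succ⟩ : ℕ) = s + 1 + (sigmaIdx α j i : ℕ) := rfl

theorem wpG_lt {s : ℕ} (α : Fin (s + 1) → ℕ)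
    (hP : (∑ j, (α j + 1)) = (s + ∑ j, α j) + 1) {j j' : Fin (s + 1)}
    (i : Fin (α j + 1)) (i' : Fin (α j' + 1)) (h : j < j') :
    wpG α hP ⟨j, i⟩ < wpG α hP ⟨j', i'⟩ :=
  wp_sigmaIdx_lt (fun j' => α j' + 1) i i' h

theorem wpG_lt_iff {s : ℕ} (α : Fin (s + 1) → ℕ)
    (hP : (∑ j, (α j + 1)) = (s + ∑ j, α j) + 1) {j : Fin (s + 1)}
    (i : Fin (α j + 1)) (i' : Fin (α j + 1)) :
    wpG α hP ⟨j, i⟩ < wpG α hP ⟨j, i'⟩ ↔ i < i' :=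
  wp_sigmaIdx_lt_iff (fun j' => α j' + 1) i i'

theorem wp_entry {s : ℕ} (α : Fin (s + 1) → ℕ)
    (hP : (∑ j, (α j + 1)) = (s + ∑ j, α j) + 1) (x y : Σ j, Fin (α j + 1)) :
    (if wpG α hP x < wpG α hP y then
        (if wpH α x < wpH α y then (1 : ℤˣ) else -1) else 1)
      = if x.1 < y.1 ∧ y.2 = 0 ∧ x.2 ≠ 0 then -1 else 1 := by
  obtain ⟨k, i⟩ := x
  obtain ⟨j, l⟩ := y
  rcases lt_trichotomy k j with h | rfl | h
  · rw [if_pos (wpG_lt α hP i l h)]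
    have hlt : (k : ℕ) < j := h
    have hk := k.isLt
    have hj := j.isLt
    induction i using Fin.cases with
    | zero =>
      rw [if_pos, if_neg (by simp)]
      rw [Fin.lt_def, wpH_zero]
      induction l using Fin.cases with
      | zero => rw [wpH_zero]; exact h
      | succ l => rw [wpH_succ]; omega
    | succ i =>
      induction l using Fin.cases with
      | zero =>
        rw [if_neg, if_pos ⟨h, rfl, Fin.succ_ne_zero _⟩]
        rw [Fin.lt_def, wpH_zero, wpH_succ]
        omega
      | succ l =>
        rw [if_pos, if_neg (by simp)]
        rw [Fin.lt_def, wpH_succ, wpH_succ]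
        have : (sigmaIdx α k i : ℕ) < sigmaIdx α j l := wp_sigmaIdx_lt α i l h
        omega
  · rw [if_neg (c := _ ∧ _) (by simp)]
    split_ifs with h1 h2
    · rfl
    · exfalso
      apply h2
      rw [wpG_lt_iff] at h1
      have hk := k.isLt
      rw [Fin.lt_def]
      induction l using Fin.cases with
      | zero => simp at h1
      | succ l =>
        induction i using Fin.cases with
        | zero => rw [wpH_zero, wpH_succ]; omega
        | succ i =>
          rw [wpH_succ, wpH_succ]
          have : (sigmaIdx α k i : ℕ) < sigmaIdx α k l :=
            (wp_sigmaIdx_lt_iff α i l).2 (Fin.succ_lt_succ_iff.1 h1)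
          omega
    · rfl
  · rw [if_neg (wpG_lt α hP l i h).not_gt, if_neg]
    rintro ⟨h1, -⟩
    exact absurd h1 h.not_gt

theorem wp_sign {s : ℕ} (α : Fin (s + 1) → ℕ)
    (hP : (∑ j, (α j + 1)) = (s + ∑ j, α j) + 1) :
    Perm.sign ((wpG α hP).symm.trans (wpH α)) =
      (-1 : ℤˣ) ^ (∑ j : Fin (s + 1), (s - (j : ℕ)) * α j) := by
  rw [Perm.sign_eq_prod_prod_Iio]
  have h1 : ∀ j : Fin ((s + ∑ j, α j) + 1), ∀ f : Fin ((s + ∑ j, α j) + 1) → ℤˣ,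
      ∏ i ∈ Finset.Iio j, f i = ∏ i, if i < j then f i else 1 := by
    intro j f
    rw [← Finset.prod_filter]
    congr 1
    ext
    simp
  simp_rw [h1]
  rw [← Equiv.prod_comp (wpG α hP)]
  simp_rw [← Equiv.prod_comp (wpG α hP) (fun i => if i < wpG α hP _ then _ else _)]
  simp only [Equiv.trans_apply, Equiv.symm_apply_apply]
  simp_rw [wp_entry]
  rw [Finset.prod_comm]
  rw [Fintype.prod_sigma, ← Finset.prod_pow_eq_pow_sum]
  refine Finset.prod_congr rfl fun k _ => ?_
  rw [Fin.prod_univ_succ]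
  have h2 : ∀ i : Fin (α k), (∏ x : (Σ j, Fin (α j + 1)),
      if k < x.1 ∧ x.2 = 0 ∧ i.succ ≠ 0 then (-1 : ℤˣ) else 1) = (-1) ^ (s - (k : ℕ)) := by
    intro i
    rw [Fintype.prod_sigma]
    have h3 : ∀ j : Fin (s + 1), (∏ l : Fin (α j + 1),
        if k < j ∧ l = 0 ∧ i.succ ≠ 0 then (-1 : ℤˣ) else 1) = if k < j then -1 else 1 := by
      intro j
      rw [Fin.prod_univ_succ]
      simp
    simp only [h3]
    rw [← Finset.prod_filter, Finset.prod_const]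
    congr 1
    have : (Finset.univ.filter fun j : Fin (s + 1) => k < j) = Finset.Ioi k := by ext; simp
    rw [this, Fin.card_Ioi]
    omega
  simp only [h2]
  simp [pow_mul]

theorem wp_core {s : ℕ} (α : Fin (s + 1) → ℕ)
    (hP : (∑ j, (α j + 1)) = (s + ∑ j, α j) + 1)
    (t : Fin (s + 1) → ℝ) (dt : Fin (s + 1) → Fin (s + ∑ j, α j) → ℝ)
    (μ : (j : Fin (s + 1)) → Fin (α j + 1) → ℝ)
    (dμ : (j : Fin (s + 1)) → Fin (α j + 1) → Fin (s + ∑ j, α j) → ℝ)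
    (h1 : ∑ j, t j = 1) (h2 : ∀ c, ∑ j, dt j c = 0)
    (h3 : ∀ j, ∑ i, μ j i = 1) (h4 : ∀ j c, ∑ i, dμ j i c = 0)
    (G : Fin ((s + ∑ j, α j) + 1) → Fin ((s + ∑ j, α j) + 1) → ℝ)
    (hG : ∀ j i, G (Fin.cast hP (sigmaIdx (fun j' => α j' + 1) j i)) =
      Fin.cons (t j * μ j i) (fun c => t j * dμ j i c + μ j i * dt j c))
    (A : Fin (s + ∑ j, α j) → Fin (s + ∑ j, α j) → ℝ)
    (hA1 : ∀ r, A (Fin.castAdd _ r) = dt r.succ)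
    (hA2 : ∀ j i, A (Fin.natAdd s (sigmaIdx α j i)) = dμ j i.succ) :
    (Matrix.of G).det = (-1 : ℝ) ^ (∑ j : Fin (s + 1), (s - (j : ℕ)) * α j) *
      (∏ j, t j ^ α j) * (Matrix.of A).det := by
  -- reduced rows
  let a : (Σ j, Fin (α j + 1)) → ℝ := fun y =>
    Fin.cases (motive := fun _ => ℝ) (t y.1) (fun _ => 0) y.2
  let D : (Σ j, Fin (α j + 1)) → Fin (s + ∑ j, α j) → ℝ := fun y =>
    Fin.cases (motive := fun _ => Fin (s + ∑ j, α j) → ℝ) (dt y.1) (fun i => dμ y.1 i.succ) y.2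
  let w : (Σ j, Fin (α j + 1)) → ℝ := fun y =>
    Fin.cases (motive := fun _ => ℝ) 1 (fun _ => t y.1) y.2
  let R : (Σ j, Fin (α j + 1)) → Fin ((s + ∑ j, α j) + 1) → ℝ := fun y => Fin.cons (a y) (D y)
  let Q : (j : Fin (s + 1)) → Fin (α j + 1) → Fin (α j) → ℝ := fun j i =>
    Fin.cases (motive := fun _ => Fin (α j) → ℝ) (fun _ => -1) (fun i k => if i = k then 1 else 0) i
  let P : (j : Fin (s + 1)) → Matrix (Fin (α j + 1)) (Fin (α j + 1)) ℝ := fun j =>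
    Matrix.of fun i k => (Fin.cons (μ j i) (Q j i) : Fin (α j + 1) → ℝ) k
  have hPdet : ∀ j, (P j).det = 1 := by
    intro j
    have := wp_bordered (μ j) (Q j) (fun _ => 1) rfl (by simpa using h3 j) (by
      intro k
      rw [Fin.sum_univ_succ]
      simp [Q])
    rw [show (P j).det = _ from this]
    have h : (Matrix.of fun r k : Fin (α j) => Q j r.succ k) = 1 := by
      ext r k
      simp [Q, Matrix.one_apply]
    rw [h, Matrix.det_one]
  have e1 : (Matrix.of G).submatrix (wpG α hP) (wpG α hP)
      = Matrix.blockDiagonal' P * Matrix.of (fun y z => w y *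
        ((Matrix.of fun y z => R y (wpG α hP z)) : Matrix _ _ ℝ) y z) := by
    ext ⟨j, i⟩ z
    rw [Matrix.mul_apply, Fintype.sum_sigma]
    refine Eq.trans ?_ (Finset.sum_eq_single j ?_ ?_).symm
    · simp only [Matrix.blockDiagonal'_apply_eq, Matrix.submatrix_apply, Matrix.of_apply]
      rw [wpG_apply, hG]
      generalize wpG α hP z = n
      refine Eq.trans ?_ (Fin.sum_univ_succ _).symm
      induction n using Fin.cases with
      | zero => simp [P, R, w, a]; ring
      | succ n =>
        simp [P, R, w, D]
        have h5 := (Fin.sum_univ_succ (fun i => dμ j i n)).symm.trans (h4 j n)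
        induction i using Fin.cases with
        | zero =>
          simp [Q, ← Finset.mul_sum]
          linear_combination t j * h5
        | succ i =>
          simp [Q]
          ring
    · intro b _ hb
      refine Finset.sum_eq_zero fun k _ => ?_
      rw [Matrix.blockDiagonal'_apply_ne _ _ _ (Ne.symm hb), zero_mul]
    · simp
  let K : Matrix (Fin ((s + ∑ j, α j) + 1)) (Fin ((s + ∑ j, α j) + 1)) ℝ :=
    Matrix.of fun n k => (Fin.cons (a ((wpH α).symm n)) (D ((wpH α).symm n)) :
      Fin ((s + ∑ j, α j) + 1) → ℝ) k
  have e2 : ((Matrix.of fun y z => R y (wpG α hP z)) : Matrix _ _ ℝ).det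
      = (-1 : ℝ) ^ (∑ j : Fin (s + 1), (s - (j : ℕ)) * α j) * K.det := by
    have h5 : ((Matrix.of fun y z => R y (wpG α hP z)) : Matrix _ _ ℝ)
      = (K.submatrix ((wpG α hP).symm.trans (wpH α)) id).submatrix (wpG α hP) (wpG α hP) := by
      ext y z
      simp [K, R]
    rw [h5, Matrix.det_submatrix_equiv_self, Matrix.det_permute, wp_sign]
    push_cast
    rfl
  have z0 : (wpH α).symm 0 = ⟨0, 0⟩ := by
    rw [Equiv.symm_apply_eq]
    rfl
  have e3 : K.det = (Matrix.of A).det := by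
    let c : (Σ j, Fin (α j + 1)) → ℝ := fun y =>
      Fin.cases (motive := fun _ => ℝ) 1 (fun _ => 0) y.2
    have h5 := wp_bordered (fun n => a ((wpH α).symm n)) (fun n => D ((wpH α).symm n))
      (fun n => c ((wpH α).symm n)) (by simp only [z0]; rfl)
      (by
        rw [Equiv.sum_comp (wpH α).symm (fun y => c y * a y), Fintype.sum_sigma, ← h1]
        refine Finset.sum_congr rfl fun j _ => ?_
        rw [Fin.sum_univ_succ]
        simp [c, a])
      (by
        intro k
        rw [Equiv.sum_comp (wpH α).symm (fun y => c y * D y k), Fintype.sum_sigma, ← h2 k]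
        refine Finset.sum_congr rfl fun j _ => ?_
        rw [Fin.sum_univ_succ]
        simp [c, D])
    rw [show K.det = _ from h5]
    congr 1
    ext r k
    simp only [Matrix.of_apply]
    induction r using Fin.addCases with
    | left r =>
      rw [hA1]
      have : (wpH α).symm (Fin.castAdd _ r).succ = ⟨r.succ, 0⟩ := by
        rw [Equiv.symm_apply_eq]
        apply Fin.ext
        rw [wpH_zero]
        simp
      rw [this]
      rfl
    | right r =>
      obtain ⟨⟨j, i⟩, rfl⟩ := (wp_sigmaIdx_bij α).2 r
      simp only
      rw [hA2]
      have : (wpH α).symm (Fin.natAdd s (sigmaIdx α j i)).succ = ⟨j, i.succ⟩ := by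
        rw [Equiv.symm_apply_eq]
        apply Fin.ext
        rw [wpH_succ]
        simp
        ring
      rw [this]
      rfl
  have e4 : ∏ y, w y = ∏ j, t j ^ α j := by
    rw [Fintype.prod_sigma]
    refine Finset.prod_congr rfl fun j _ => ?_
    rw [Fin.prod_univ_succ]
    simp [w]
  rw [← Matrix.det_submatrix_equiv_self (wpG α hP), e1, Matrix.det_mul, wp_det_blockDiagonal,
    Matrix.det_mul_column, e2, e3, e4]
  simp only [hPdet, Finset.prod_const_one]
  ring

theorem wp_fderiv_sum {E : Type*} [NormedAddCommGroup E] [NormedSpace ℝ E] {n : ℕ}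
    (f : Fin n → E → ℝ) (sset : Set E) (hso : IsOpen sset)
    (hf : ∀ j, ContDiffOn ℝ (⊤ : ℕ∞) (f j) sset)
    (hsum : ∀ y ∈ sset, ∑ j, f j y = 1) (x : E) (hx : x ∈ sset) (w : E) :
    ∑ j, fderiv ℝ (f j) x w = 0 := by
  have hd : ∀ j, DifferentiableAt ℝ (f j) x := fun j =>
    ((hf j).contDiffAt (hso.mem_nhds hx)).differentiableAt (by simp)
  have h1 : fderiv ℝ (fun y => ∑ j, f j y) x = 0 := by
    have : (fun y => ∑ j, f j y) =ᶠ[nhds x] fun _ => (1 : ℝ) := by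
      filter_upwards [hso.mem_nhds hx] with y hy using hsum y hy
    rw [this.fderiv_eq]
    simp
  rw [fderiv_fun_sum (fun j _ => hd j)] at h1
  have := congrArg (fun L => L w) h1
  simpa using this

theorem wp_whitney_det' {E : Type*} [NormedAddCommGroup E] [NormedSpace ℝ E]
    {p : ℕ} (f : Fin (p + 1) → E → ℝ) (sset : Set E) (hso : IsOpen sset)
    (hf : ∀ j, ContDiffOn ℝ (⊤ : ℕ∞) (f j) sset)
    (hsum : ∀ y ∈ sset, ∑ j, f j y = 1) (x : E) (hx : x ∈ sset) (v : Fin p → E) :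
    whitneyForm f x v = (Nat.factorial p : ℝ) *
      Matrix.det (Matrix.of fun i k : Fin p => fderiv ℝ (f i.succ) x (v k)) := by
  rw [wp_whitney_det]
  congr 1
  exact wp_bordered (fun i => f i x) (fun i c => fderiv ℝ (f i) x (v c)) (fun _ => 1) rfl
    (by simpa using hsum x hx)
    (fun k => by simpa using wp_fderiv_sum f sset hso hf hsum x hx (v k))

end helpers2

/-- Proposition `IMINVE`: for the iterated join `σ = σ_0 * ⋯ * σ_s`
over `τ`, with barycentric coordinates `t_j` of `τ` and `μ_{j,i}` of `σ_j` (smooth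
functions summing to 1 on an open set), composite coordinates `λ_{j,i} = t_j μ_{j,i}`
of `σ` ordered by a permutation `ν` relative to the grouped order, one has
`ψ*(ω(σ)) = (-1)^{a(ν)} (-1)^{Σ_j (s−j)|σ_j|} (p!/(|σ_0|!⋯|σ_s|! s!))
  t_0^{|σ_0|} ⋯ t_s^{|σ_s|} ω(τ) ∧ ω(σ_0) ∧ ⋯ ∧ ω(σ_s)`, `p = s + Σ_j |σ_j|`. -/
theorem whitneyForm_pullback_prism {s : ℕ} (α : Fin (s + 1) → ℕ)
    (t : Fin (s + 1) → E → ℝ) (μ : (j : Fin (s + 1)) → Fin (α j + 1) → E → ℝ)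
    (sset : Set E) (hso : IsOpen sset)
    (ht : ∀ j, ContDiffOn ℝ (⊤ : ℕ∞) (t j) sset)
    (hμ : ∀ j i, ContDiffOn ℝ (⊤ : ℕ∞) (μ j i) sset)
    (hsumt : ∀ y ∈ sset, ∑ j, t j y = 1)
    (hsumμ : ∀ j, ∀ y ∈ sset, ∑ i, μ j i y = 1)
    (hP : (∑ j, (α j + 1)) = (s + ∑ j, α j) + 1)
    (ν : Equiv.Perm (Fin ((s + ∑ j, α j) + 1)))
    (lam : Fin ((s + ∑ j, α j) + 1) → E → ℝ)
    (hlam : ∀ j i, lam (ν.symm (Fin.cast hP (sigmaIdx (fun j' => α j' + 1) j i))) =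
      fun y => t j y * μ j i y)
    (x : E) (hx : x ∈ sset) (v : Fin (s + ∑ j, α j) → E) :
    whitneyForm lam x v =
      ((Equiv.Perm.sign ν : ℤ) : ℝ) * (-1 : ℝ) ^ (∑ j : Fin (s + 1), (s - (j : ℕ)) * α j) *
        ((Nat.factorial (s + ∑ j, α j) : ℝ) /
          ((∏ j, (Nat.factorial (α j) : ℝ)) * (Nat.factorial s : ℝ))) *
        (∏ j, t j x ^ α j) *
        wedgeForm (whitneyForm t x) (bigWedge α fun j => whitneyForm (μ j) x) v := by
  obtain ⟨e, he⟩ : ∃ e : (Σ j, Fin (α j)) ≃ Fin (∑ j, α j), ∀ j i, e ⟨j, i⟩ = sigmaIdx α j i :=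
    ⟨Equiv.ofBijective _ (wp_sigmaIdx_bij α), fun _ _ => rfl⟩
  have he' : ∀ j i, e.symm (sigmaIdx α j i) = ⟨j, i⟩ := fun j i => by
    rw [← he, Equiv.symm_apply_apply]
  let Z : Fin (∑ j, α j) → E → ℝ := fun r =>
    fderiv ℝ (μ (e.symm r).1 (e.symm r).2.succ) x
  have hZ : ∀ j i w, Z (sigmaIdx α j i) w = fderiv ℝ (μ j i.succ) x w := by
    intro j i w
    exact congrArg (fun y : Σ j, Fin (α j) => fderiv ℝ (μ y.1 y.2.succ) x w) (he' j i)
  have hne : (∏ j, (Nat.factorial (α j) : ℝ)) ≠ 0 :=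
    Finset.prod_ne_zero_iff.2 fun j _ => by positivity
  have hbw : ∀ u : Fin (∑ j, α j) → E, bigWedge α (fun j => whitneyForm (μ j) x) u =
      (∏ j, (Nat.factorial (α j) : ℝ)) *
      Matrix.det (Matrix.of fun r c : Fin (∑ j, α j) => Z r (u c)) := by
    intro u
    have h := wp_laplace_sigma α e (fun r c : Fin (∑ j, α j) => Z r (u c))
    simp only [he, hZ] at h
    rw [bigWedge, ← h, Finset.mul_sum]
    refine Finset.sum_congr rfl fun σ _ => ?_
    have h5 : ∀ j, whitneyForm (μ j) x (fun i => u (σ (sigmaIdx α j i))) =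
        (Nat.factorial (α j) : ℝ) * Matrix.det (Matrix.of fun r c : Fin (α j) =>
          fderiv ℝ (μ j r.succ) x (u (σ (sigmaIdx α j c)))) := fun j =>
      wp_whitney_det' (μ j) sset hso (hμ j) (hsumμ j) x hx _
    simp only [h5, Finset.prod_mul_distrib]
    field_simp
  let A : Fin (s + ∑ j, α j) → Fin (s + ∑ j, α j) → ℝ := fun r =>
    Fin.addCases (motive := fun _ => Fin (s + ∑ j, α j) → ℝ)
      (fun r c => fderiv ℝ (t r.succ) x (v c)) (fun r c => Z r (v c)) r
  have hA1 : ∀ r c, A (Fin.castAdd _ r) c = fderiv ℝ (t r.succ) x (v c) := fun r c => by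
    simp only [A, Fin.addCases_left]
  have hA2 : ∀ r c, A (Fin.natAdd s r) c = Z r (v c) := fun r c => by
    simp only [A, Fin.addCases_right]
  have hw : wedgeForm (whitneyForm t x) (bigWedge α fun j => whitneyForm (μ j) x) v =
      (Nat.factorial s : ℝ) * (∏ j, (Nat.factorial (α j) : ℝ)) * (Matrix.of A).det := by
    have h := wp_laplace_sum (k := s) (l := ∑ j, α j) A
    simp only [hA1, hA2] at h
    rw [wedgeForm, inv_mul_eq_iff_eq_mul₀ (by positivity)]
    have h6 : ∀ u, whitneyForm t x u = (Nat.factorial s : ℝ) *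
        Matrix.det (Matrix.of fun i k : Fin s => fderiv ℝ (t i.succ) x (u k)) :=
      fun u => wp_whitney_det' t sset hso ht hsumt x hx u
    simp only [hbw, h6]
    rw [mul_left_comm, ← h, Finset.mul_sum]
    refine Finset.sum_congr rfl fun σ _ => ?_
    ring
  have htd : ∀ j, DifferentiableAt ℝ (t j) x := fun j =>
    ((ht j).contDiffAt (hso.mem_nhds hx)).differentiableAt (by simp)
  have hμd : ∀ j i, DifferentiableAt ℝ (μ j i) x := fun j i =>
    ((hμ j i).contDiffAt (hso.mem_nhds hx)).differentiableAt (by simp)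
  let B : Fin ((s + ∑ j, α j) + 1) → Fin ((s + ∑ j, α j) + 1) → ℝ := fun n =>
    Fin.cons (lam n x) (fun c => fderiv ℝ (lam n) x (v c))
  have hcore := wp_core α hP (fun j => t j x) (fun j c => fderiv ℝ (t j) x (v c))
    (fun j i => μ j i x) (fun j i c => fderiv ℝ (μ j i) x (v c)) (hsumt x hx)
    (fun c => wp_fderiv_sum t sset hso ht hsumt x hx (v c)) (fun j => hsumμ j x hx)
    (fun j c => wp_fderiv_sum (μ j) sset hso (hμ j) (hsumμ j) x hx (v c))
    (fun n => B (ν.symm n))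
    (by
      intro j i
      simp only [B]
      rw [hlam]
      congr 1
      funext c
      rw [fderiv_fun_mul (htd j) (hμd j i)]
      simp)
    A (fun r => funext fun c => hA1 r c)
    (fun j i => funext fun c => by rw [hA2, hZ])
  have hB : (Matrix.of B).det =
      ((Equiv.Perm.sign ν : ℤ) : ℝ) * (Matrix.of fun n => B (ν.symm n)).det := by
    rw [← Matrix.det_permute]
    congr 1
    ext n k
    simp
  rw [wp_whitney_det, hw]
  change _ * (Matrix.of B).det = _
  rw [hB, hcore]
  field_simp
end
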